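/- Let M and D be positive integers, set L = 2M+1, and let Λ = {−M, …, M}^D ⊆ ℤ^D. For ℓ ∈ {1, …, D} define X_ℓ : Λ → ℝ by X_ℓ(n) = n_ℓ. Let R be an integer with 1 ≤ R < M, and let V_R ⊆ ℂ^Λ be the span of the Fourier vectors (exp(2πi k·n/L))_{n ∈ Λ} over k ∈ Λ with ‖k‖₂ ≤ R. Then, with Π the orthogonal projection onto V_R, (∑_{ℓ=1}^{D} ‖X_ℓ − ΠX_ℓ‖²) / (∑_{ℓ=1}^{D} ‖X_ℓ‖²) ≤ (6/π²) · (L²/(L²−1)) · (1/R), where ‖·‖ is the standard Euclidean (Hermitian) norm on ℂ^Λ. -/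

import Mathlib

open Finset Real Complex

/-- Extending a symmetric integer interval by one adds its two endpoints. -/
lemma sum_Icc_neg_succ {A : Type*} [AddCommMonoid A] (g : ℤ → A) (M : ℕ) :
    ∑ k ∈ Icc (-((M + 1 : ℕ) : ℤ)) ((M + 1 : ℕ) : ℤ), g k =
      g (-((M : ℤ) + 1)) + g ((M : ℤ) + 1) + ∑ k ∈ Icc (-(M : ℤ)) M, g k := by
  have h : Icc (-((M + 1 : ℕ) : ℤ)) ((M + 1 : ℕ) : ℤ) =
      insert (-((M : ℤ) + 1)) (insert ((M : ℤ) + 1) (Icc (-(M : ℤ)) M)) := by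
    ext x
    simp only [mem_Icc, mem_insert]
    omega
  rw [h, sum_insert, sum_insert, add_assoc]
  · simp
  · simp only [mem_Icc, mem_insert]
    omega

lemma sum_Icc_neg_sub {A : Type*} [AddCommGroup A] (F : ℤ → A) (M : ℕ) :
    ∑ n ∈ Icc (-(M : ℤ)) M, (F (n + 1) - F n) = F (M + 1) - F (-M) := by
  induction M with
  | zero => simp
  | succ M ih =>
    rw [sum_Icc_neg_succ, ih]
    push_cast
    rw [show -((M : ℤ) + 1) + 1 = -M by ring]
    abel

lemma sum_Icc_neg_sq (M : ℕ) :
    ∑ n ∈ Icc (-(M : ℤ)) M, (n : ℝ) ^ 2 = (2 * M + 1) * ((2 * M + 1) ^ 2 - 1) / 12 := by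
  induction M with
  | zero => simp
  | succ M ih =>
    rw [sum_Icc_neg_succ, ih]
    push_cast
    ring

/-- An even function summed over `R < |k| ≤ M`. -/
lemma sum_Icc_neg_sdiff (g : ℤ → ℝ) (hg : ∀ k, g (-k) = g k) {R M : ℕ} (hRM : R ≤ M) :
    ∑ k ∈ Icc (-(M : ℤ)) M \ Icc (-(R : ℤ)) R, g k = 2 * ∑ k ∈ Ico R M, g (k + 1) := by
  rw [sum_sdiff_eq_sub (Icc_subset_Icc (by omega) (by omega))]
  induction M, hRM using Nat.le_induction with
  | base => simp
  | succ M hM ih =>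
    rw [sum_Icc_neg_succ, sum_Ico_succ_top hM, hg, mul_add, ← ih]
    ring

/-- Midpoint (Hermite–Hadamard) estimate for `1 / sin ^ 2`, whose primitive is `-cot`. -/
lemma one_div_sin_sq_le {x h : ℝ} (h0 : 0 < h) (hx : h < x) (hxh : x + h < π) :
    1 / Real.sin x ^ 2 ≤
      (Real.cos (x - h) / Real.sin (x - h) - Real.cos (x + h) / Real.sin (x + h)) / (2 * h) := by
  have s1 : 0 < Real.sin (x - h) := sin_pos_of_pos_of_lt_pi (by linarith) (by linarith)
  have s2 : 0 < Real.sin (x + h) := sin_pos_of_pos_of_lt_pi (by linarith) (by linarith)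
  have s3 : 0 < Real.sin x := sin_pos_of_pos_of_lt_pi (by linarith) (by linarith)
  have s4 : 0 < Real.sin h := sin_pos_of_pos_of_lt_pi (by linarith) (by linarith)
  have hc : h * Real.cos h ≤ Real.sin h := by
    have hh : h < π / 2 := by linarith
    have c0 : 0 < Real.cos h := cos_pos_of_mem_Ioo ⟨by linarith, hh⟩
    have := (lt_tan h0 hh).le
    rwa [Real.tan_eq_sin_div_cos, le_div_iff₀ c0] at this
  have e1 : Real.cos (x - h) / Real.sin (x - h) - Real.cos (x + h) / Real.sin (x + h) =
      2 * Real.sin h * Real.cos h / (Real.sin (x - h) * Real.sin (x + h)) := by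
    rw [div_sub_div _ _ s1.ne' s2.ne']
    congr 1
    rw [Real.sin_add, Real.sin_sub, Real.cos_add, Real.cos_sub]
    linear_combination (2 * Real.sin h * Real.cos h) * Real.sin_sq_add_cos_sq x
  have e2 : Real.sin (x - h) * Real.sin (x + h) = Real.sin x ^ 2 - Real.sin h ^ 2 := by
    rw [Real.sin_add, Real.sin_sub]
    linear_combination Real.sin x ^ 2 * Real.sin_sq_add_cos_sq h - Real.sin h ^ 2 * Real.sin_sq_add_cos_sq x
  have hpos : 0 < Real.sin (x - h) * Real.sin (x + h) := mul_pos s1 s2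
  rw [e1, div_div, div_le_div_iff₀ (by positivity) (by positivity), e2]
  have k1 : Real.sin x ^ 2 ≤ 1 := sin_sq_le_one x
  have k2 : Real.cos h ^ 2 = 1 - Real.sin h ^ 2 := Real.cos_sq' h
  have c0 : 0 ≤ Real.cos h := cos_nonneg_of_mem_Icc ⟨by linarith, by linarith⟩
  have k3 : h * Real.cos h ^ 2 ≤ Real.sin h * Real.cos h := by nlinarith
  rw [k2] at k3
  nlinarith [mul_le_mul_of_nonneg_right k3 (sq_nonneg (Real.sin x)),
    mul_nonneg (mul_nonneg h0.le (sq_nonneg (Real.sin h))) (sub_nonneg.2 k1)]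

/-- Tail bound for `∑ 1 / sin ^ 2 (π k / L)`, `L = 2 * M + 1`. -/
lemma sum_one_div_sin_sq_le {R M : ℕ} (hR : 0 < R) (hRM : R < M) :
    ∑ k ∈ Ico R M, 1 / Real.sin (π * (k + 1) / (2 * M + 1)) ^ 2 ≤
      (2 * M + 1) ^ 2 / (π ^ 2 * R) := by
  have hπ := pi_pos
  have hL : (0 : ℝ) < 2 * M + 1 := by positivity
  set L : ℝ := 2 * M + 1 with hLdef
  let C : ℕ → ℝ := fun k => Real.cos (π * (2 * k + 1) / (2 * L)) / Real.sin (π * (2 * k + 1) / (2 * L))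
  have step : ∀ k ∈ Ico R M, 1 / Real.sin (π * (k + 1) / L) ^ 2 ≤ L / π * (C k - C (k + 1)) := by
    intro k hk
    rw [mem_Ico] at hk
    have hkM : (k : ℝ) + 1 ≤ M := by exact_mod_cast hk.2
    have := one_div_sin_sq_le (x := π * (k + 1) / L) (h := π / (2 * L)) (by positivity)
      (by
        rw [div_lt_div_iff₀ (by positivity) hL]
        have : 0 < π * L := by positivity
        nlinarith [mul_nonneg this.le (Nat.cast_nonneg (α := ℝ) k)])
      (by
        rw [show π * (k + 1) / L + π / (2 * L) = π * ((2 * k + 3) / (2 * L)) by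
          field_simp; ring]
        apply mul_lt_of_lt_one_right hπ
        rw [div_lt_one (by positivity)]
        linarith)
    rw [show π * (k + 1) / L - π / (2 * L) = π * (2 * k + 1) / (2 * L) by field_simp; ring,
      show π * (k + 1) / L + π / (2 * L) = π * (2 * (k + 1 : ℕ) + 1) / (2 * L) by
        push_cast; field_simp] at this
    refine this.trans_eq ?_
    simp only [C]
    field_simp
  refine (sum_le_sum step).trans ?_
  rw [← mul_sum]
  have tel : ∑ k ∈ Ico R M, (C k - C (k + 1)) = C R - C M := by
    rw [← neg_sub (C M), ← sum_Ico_sub C hRM.le, ← sum_neg_distrib]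
    simp
  have hCM : C M = 0 := by
    simp only [C]
    rw [← hLdef, show π * L / (2 * L) = π / 2 by field_simp]
    simp
  have hCR : C R ≤ L / (π * R) := by
    have hRM' : (R : ℝ) < M := by exact_mod_cast hRM
    have hR' : (0 : ℝ) < R := by exact_mod_cast hR
    set y := π * (2 * R + 1) / (2 * L) with hy
    have y0 : 0 < y := by positivity
    have y1 : y < π / 2 := by
      rw [hy, div_lt_div_iff₀ (by positivity) (by positivity)]
      nlinarith
    have hs : 0 < Real.sin y := sin_pos_of_pos_of_lt_pi y0 (by linarith)
    have hc : 0 < Real.cos y := cos_pos_of_mem_Ioo ⟨by linarith, y1⟩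
    have ht := (lt_tan y0 y1).le
    rw [Real.tan_eq_sin_div_cos, le_div_iff₀ hc] at ht
    have : C R ≤ 1 / y := by
      simp only [C]
      rw [← hy, div_le_div_iff₀ hs y0]
      linarith
    refine this.trans ?_
    rw [hy, one_div_div, div_le_div_iff₀ (by positivity) (by positivity)]
    have : 0 < L * π := by positivity
    nlinarith
  rw [tel, hCM, sub_zero]
  calc L / π * C R ≤ L / π * (L / (π * R)) := by gcongr
    _ = _ := by field_simp

/-- The characters of period `2 * M + 1` agree at `M + 1` and `-M`. -/
lemma IsPrimitiveRoot.zpow_mul_succ {ζ : ℂ} {M : ℕ} (hζ : IsPrimitiveRoot ζ (2 * M + 1)) (d : ℤ) :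
    ζ ^ (d * ((M : ℤ) + 1)) = ζ ^ (d * (-(M : ℤ))) := by
  rw [show d * ((M : ℤ) + 1) = d * (-(M : ℤ)) + ((2 * M + 1 : ℕ) : ℤ) * d by push_cast; ring,
    zpow_add₀ (hζ.ne_zero (by omega)), zpow_mul ζ ((2 * M + 1 : ℕ) : ℤ), zpow_natCast,
    hζ.pow_eq_one, one_zpow, mul_one]

/-- Full geometric sums over a symmetric period vanish. -/
lemma IsPrimitiveRoot.sum_Icc_neg_zpow {ζ : ℂ} {M : ℕ} (hζ : IsPrimitiveRoot ζ (2 * M + 1))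
    {d : ℤ} (hd : ¬ (2 * (M : ℤ) + 1) ∣ d) :
    ∑ n ∈ Icc (-(M : ℤ)) M, ζ ^ (d * n) = 0 := by
  have h0 : ζ ≠ 0 := hζ.ne_zero (by omega)
  have hne : ζ ^ d - 1 ≠ 0 := by
    rw [sub_ne_zero, Ne, hζ.zpow_eq_one_iff_dvd]
    exact_mod_cast hd
  have h := sum_Icc_neg_sub (fun n => ζ ^ (d * n)) M
  rw [hζ.zpow_mul_succ, sub_self] at h
  simp only [mul_add, mul_one, zpow_add₀ h0] at h
  simp_rw [show ∀ n : ℤ, ζ ^ (d * n) * ζ ^ d - ζ ^ (d * n) = ζ ^ (d * n) * (ζ ^ d - 1) from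
    fun n => by ring] at h
  rw [← sum_mul] at h
  exact (mul_eq_zero.1 h).resolve_right hne

/-- Orthogonality of the characters `n ↦ ζ ^ (k * n)`. -/
lemma IsPrimitiveRoot.sum_Icc_neg_zpow_sub {ζ : ℂ} {M : ℕ}
    (hζ : IsPrimitiveRoot ζ (2 * M + 1)) {a b : ℤ} (ha : a ∈ Icc (-(M : ℤ)) M)
    (hb : b ∈ Icc (-(M : ℤ)) M) :
    ∑ n ∈ Icc (-(M : ℤ)) M, ζ ^ ((a - b) * n) = if a = b then (2 * M + 1 : ℂ) else 0 := by
  split_ifs with hab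
  · subst hab
    simp only [sub_self, zero_mul, zpow_zero, sum_const, Int.card_Icc, nsmul_eq_mul, mul_one]
    rw [show (M + 1 - (-(M : ℤ))).toNat = 2 * M + 1 by omega]
    push_cast
    rfl
  · apply hζ.sum_Icc_neg_zpow
    rw [mem_Icc] at ha hb
    intro h
    apply hab
    have := Int.eq_zero_of_abs_lt_dvd h (by rw [abs_lt]; omega)
    omega

/-- The transform of the identity at a nonzero frequency. -/
lemma IsPrimitiveRoot.sum_Icc_neg_mul_zpow {ζ : ℂ} {M : ℕ} (hζ : IsPrimitiveRoot ζ (2 * M + 1))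
    {d : ℤ} (hd : ¬ (2 * (M : ℤ) + 1) ∣ d) :
    (∑ n ∈ Icc (-(M : ℤ)) M, (n : ℂ) * ζ ^ (d * n)) * (ζ ^ d - 1) =
      (2 * M + 1) * ζ ^ (d * (-(M : ℤ))) := by
  have h0 : ζ ≠ 0 := hζ.ne_zero (by omega)
  have h := sum_Icc_neg_sub (fun n => (n : ℂ) * ζ ^ (d * n)) M
  have hsplit : ∀ n : ℤ, ((n + 1 : ℤ) : ℂ) * ζ ^ (d * (n + 1)) - (n : ℂ) * ζ ^ (d * n) =
      (n : ℂ) * ζ ^ (d * n) * (ζ ^ d - 1) + ζ ^ (d * n) * ζ ^ d := by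
    intro n
    rw [mul_add, mul_one, zpow_add₀ h0]
    push_cast
    ring
  simp_rw [hsplit] at h
  rw [sum_add_distrib, ← sum_mul, ← sum_mul, hζ.sum_Icc_neg_zpow hd, hζ.zpow_mul_succ] at h
  rw [zero_mul, add_zero] at h
  rw [h]
  push_cast
  ring

lemma norm_exp_zpow_sub_one_sq (M : ℕ) (d : ℤ) :
    ‖Complex.exp (2 * π * I / (2 * M + 1)) ^ d - 1‖ ^ 2 =
      4 * Real.sin (π * d / (2 * M + 1)) ^ 2 := by
  rw [← Complex.exp_int_mul,
    show (d : ℂ) * (2 * π * I / (2 * M + 1)) = I * ((2 * π * d / (2 * M + 1) : ℝ) : ℂ) by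
      push_cast; ring,
    Complex.norm_exp_I_mul_ofReal_sub_one, Real.norm_eq_abs, sq_abs, mul_pow,
    show 2 * π * d / (2 * M + 1) / 2 = π * d / (2 * M + 1 : ℝ) by ring]
  norm_num

lemma isPrimitiveRoot_exp_odd (M : ℕ) :
    IsPrimitiveRoot (Complex.exp (2 * π * I / (2 * M + 1))) (2 * M + 1) := by
  have := Complex.isPrimitiveRoot_exp (2 * M + 1) (by omega)
  push_cast at this
  exact this

/-- The `k`-th Fourier coefficient of the identity on `{-M, …, M}`, with `ζ = exp (2πi / L)`. -/
noncomputable def identityCoeff (M : ℕ) (ζ : ℂ) (k : ℤ) : ℂ :=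
  (∑ m ∈ Icc (-(M : ℤ)) M, (m : ℂ) * ζ ^ (-k * m)) / (2 * M + 1)

lemma IsPrimitiveRoot.sum_identityCoeff {ζ : ℂ} {M : ℕ} (hζ : IsPrimitiveRoot ζ (2 * M + 1))
    {n : ℤ} (hn : n ∈ Icc (-(M : ℤ)) M) :
    ∑ k ∈ Icc (-(M : ℤ)) M, identityCoeff M ζ k * ζ ^ (k * n) = n := by
  have h0 : ζ ≠ 0 := hζ.ne_zero (by omega)
  have hL : (2 * M + 1 : ℂ) ≠ 0 := by exact_mod_cast (by omega : 2 * M + 1 ≠ 0)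
  simp only [identityCoeff, div_mul_eq_mul_div, sum_mul]
  rw [← sum_div, sum_comm, div_eq_iff hL]
  have : ∀ m ∈ Icc (-(M : ℤ)) M,
      ∑ k ∈ Icc (-(M : ℤ)) M, (m : ℂ) * ζ ^ (-k * m) * ζ ^ (k * n) =
        if n = m then (m : ℂ) * (2 * M + 1) else 0 := by
    intro m hm
    rw [← mul_ite_zero, ← hζ.sum_Icc_neg_zpow_sub hn hm, mul_sum]
    refine sum_congr rfl fun k _ => ?_
    rw [mul_assoc, ← zpow_add₀ h0]
    ring_nf
  rw [sum_congr rfl this, sum_ite_eq, if_pos hn]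

/-- Parseval for a trigonometric polynomial with frequencies in `s ⊆ {-M, …, M}`. -/
lemma IsPrimitiveRoot.sum_normSq_sum {ζ : ℂ} {M : ℕ} (hζ : IsPrimitiveRoot ζ (2 * M + 1))
    {s : Finset ℤ} (hs : s ⊆ Icc (-(M : ℤ)) M) (c : ℤ → ℂ) :
    ∑ n ∈ Icc (-(M : ℤ)) M, ‖∑ k ∈ s, c k * ζ ^ (k * n)‖ ^ 2 =
      (2 * M + 1) * ∑ k ∈ s, ‖c k‖ ^ 2 := by
  have h0 : ζ ≠ 0 := hζ.ne_zero (by omega)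
  have hconj : (starRingEnd ℂ) ζ = ζ⁻¹ :=
    (Complex.inv_eq_conj (Complex.norm_eq_one_of_pow_eq_one hζ.pow_eq_one (by omega))).symm
  apply Complex.ofReal_injective
  push_cast
  simp only [← Complex.mul_conj', map_sum, map_mul, map_zpow₀, hconj, sum_mul_sum]
  rw [sum_comm, mul_sum]
  refine sum_congr rfl fun a ha => ?_
  rw [sum_comm]
  have : ∀ b ∈ s, ∑ n ∈ Icc (-(M : ℤ)) M,
      c a * ζ ^ (a * n) * ((starRingEnd ℂ) (c b) * ζ⁻¹ ^ (b * n)) =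
        if a = b then c a * (starRingEnd ℂ) (c b) * (2 * M + 1) else 0 := by
    intro b hb
    rw [← mul_ite_zero, ← hζ.sum_Icc_neg_zpow_sub (hs ha) (hs hb), mul_sum]
    refine sum_congr rfl fun n _ => ?_
    rw [sub_mul, zpow_sub₀ h0, inv_zpow]
    ring
  rw [sum_congr rfl this, sum_ite_eq, if_pos ha]
  ring

lemma norm_identityCoeff_sq {M : ℕ} {k : ℤ} (hk : ¬ (2 * (M : ℤ) + 1) ∣ k) :
    ‖identityCoeff M (Complex.exp (2 * π * I / (2 * M + 1))) k‖ ^ 2 =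
      1 / Real.sin (π * k / (2 * M + 1)) ^ 2 / 4 := by
  have hζ := isPrimitiveRoot_exp_odd M
  have hsq := norm_exp_zpow_sub_one_sq M (-k)
  set ζ := Complex.exp (2 * π * I / (2 * M + 1))
  have hL : (2 * M + 1 : ℂ) ≠ 0 := by exact_mod_cast (by omega : 2 * M + 1 ≠ 0)
  have hk' : ¬ (2 * (M : ℤ) + 1) ∣ -k := by rwa [dvd_neg]
  have hne : ζ ^ (-k) - 1 ≠ 0 := by
    rw [sub_ne_zero, Ne, hζ.zpow_eq_one_iff_dvd]
    exact_mod_cast hk'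
  have hc : identityCoeff M ζ k = ζ ^ (-k * (-(M : ℤ))) / (ζ ^ (-k) - 1) := by
    rw [identityCoeff, div_eq_div_iff hL hne, hζ.sum_Icc_neg_mul_zpow hk', mul_comm]
  have hnorm : ‖ζ‖ = 1 := Complex.norm_eq_one_of_pow_eq_one hζ.pow_eq_one (by omega)
  rw [hc, norm_div, norm_zpow, hnorm, one_zpow, div_pow, hsq]
  push_cast
  rw [mul_neg, neg_div, Real.sin_neg, neg_sq, one_pow, div_div, mul_comm]

/-- Squared error of the Fourier truncation of the identity on `{-M, …, M}`. -/
lemma sum_norm_sub_truncation_le {R M : ℕ} (hR : 0 < R) (hRM : R < M) :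
    ∑ n ∈ Icc (-(M : ℤ)) M, ‖(n : ℂ) - ∑ k ∈ Icc (-(R : ℤ)) R,
        identityCoeff M (Complex.exp (2 * π * I / (2 * M + 1))) k *
          Complex.exp (2 * π * I / (2 * M + 1)) ^ (k * n)‖ ^ 2 ≤
      (6 / π ^ 2) * ((2 * M + 1 : ℝ) ^ 2 / ((2 * M + 1 : ℝ) ^ 2 - 1)) * (1 / R) *
        ∑ n ∈ Icc (-(M : ℤ)) M, (n : ℝ) ^ 2 := by
  have hζ := isPrimitiveRoot_exp_odd M
  have hnorm := fun k => norm_identityCoeff_sq (M := M) (k := k)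
  set ζ := Complex.exp (2 * π * I / (2 * M + 1))
  have hsub : Icc (-(R : ℤ)) R ⊆ Icc (-(M : ℤ)) M := Icc_subset_Icc (by omega) (by omega)
  have hres : ∀ n ∈ Icc (-(M : ℤ)) M,
      ‖(n : ℂ) - ∑ k ∈ Icc (-(R : ℤ)) R, identityCoeff M ζ k * ζ ^ (k * n)‖ ^ 2 =
        ‖∑ k ∈ Icc (-(M : ℤ)) M \ Icc (-(R : ℤ)) R, identityCoeff M ζ k * ζ ^ (k * n)‖ ^ 2 := by
    intro n hn
    rw [sum_sdiff_eq_sub hsub, hζ.sum_identityCoeff hn]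
  have htail : ∑ k ∈ Icc (-(M : ℤ)) M \ Icc (-(R : ℤ)) R, ‖identityCoeff M ζ k‖ ^ 2 =
      (2 * ∑ k ∈ Ico R M, 1 / Real.sin (π * (k + 1) / (2 * M + 1)) ^ 2) / 4 := by
    have := sum_Icc_neg_sdiff (fun k : ℤ => 1 / Real.sin (π * k / (2 * M + 1)) ^ 2)
      (fun k => by simp [neg_div]) hRM.le
    push_cast at this
    rw [← this, sum_div]
    refine sum_congr rfl fun k hk => hnorm k fun hdvd => ?_
    simp only [mem_sdiff, mem_Icc] at hk
    have := Int.eq_zero_of_abs_lt_dvd hdvd (by rw [abs_lt]; omega)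
    omega
  rw [sum_congr rfl hres, hζ.sum_normSq_sum sdiff_subset, htail, sum_Icc_neg_sq]
  have hR' : (0 : ℝ) < R := by exact_mod_cast hR
  have hM' : (0 : ℝ) < M := by exact_mod_cast hR.trans hRM
  have hL : (2 * M + 1 : ℝ) ^ 2 - 1 ≠ 0 := by nlinarith
  calc _ ≤ (2 * M + 1) * ((2 * ((2 * M + 1) ^ 2 / (π ^ 2 * R))) / 4) := by
        gcongr
        exact sum_one_div_sin_sq_le hR hRM
    _ = _ := by
        have := pi_pos
        field_simp
        norm_num

/-- Summing a function of one coordinate over a finite power. -/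
lemma sum_comp_eval {α β : Type*} [Fintype α] [DecidableEq α] [Fintype β] (i : α) (g : β → ℝ) :
    ∑ n : α → β, g (n i) = Fintype.card ({j // j ≠ i} → β) * ∑ b, g b := by
  rw [← (Equiv.funSplitAt i β).symm.sum_comp, Fintype.sum_prod_type]
  simp [Equiv.funSplitAt, mul_sum]

/-- Linear coordinate decoding on the `D`-dimensional periodic lattice
`Λ = {−M,…,M}^D` (`L = 2M+1`): the `D` coordinate functions, projected onto the Fourier
modes of wavevector magnitude at most `R` (with `1 ≤ R < M`), have relative squared error
at most `(6/π²)·(L²/(L²−1))·(1/R)`. -/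
theorem lattice_coordinate_decoding (M D : ℕ) (hM : 0 < M) (hD : 0 < D) (R : ℕ)
    (hR1 : 1 ≤ R) (hRM : R < M) :
    let ι := {j : ℤ // j ∈ Finset.Icc (-(M : ℤ)) (M : ℤ)}
    let Λ := Fin D → ι
    let X : Fin D → EuclideanSpace ℂ Λ := fun ℓ => WithLp.toLp 2 (fun n => ((n ℓ : ℤ) : ℂ))
    let V : Submodule ℂ (EuclideanSpace ℂ Λ) :=
      Submodule.span ℂ {v : EuclideanSpace ℂ Λ | ∃ k : Λ,
        Real.sqrt (∑ i, ((k i : ℤ) : ℝ) ^ 2) ≤ (R : ℝ) ∧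
        v = (WithLp.toLp 2 (fun n => Complex.exp (2 * Real.pi * Complex.I *
          (∑ i, ((k i : ℤ) : ℂ) * ((n i : ℤ) : ℂ)) / (2 * M + 1))) :
            EuclideanSpace ℂ Λ)}
    (∑ ℓ, ‖X ℓ - (Submodule.orthogonalProjectionOnto V (X ℓ) : EuclideanSpace ℂ Λ)‖ ^ 2) /
        (∑ ℓ, ‖X ℓ‖ ^ 2) ≤
      (6 / Real.pi ^ 2) * ((2 * M + 1 : ℝ) ^ 2 / ((2 * M + 1 : ℝ) ^ 2 - 1)) *
        (1 / R) := by
  intro ι Λ X V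
  have hM' : (0 : ℝ) < M := by exact_mod_cast hM
  have hL : (0 : ℝ) < (2 * M + 1 : ℝ) ^ 2 - 1 := by nlinarith
  refine div_le_of_le_mul₀ (sum_nonneg fun _ _ => sq_nonneg _) (by positivity) ?_
  rw [mul_sum]
  refine sum_le_sum fun ℓ _ => ?_
  set ζ := Complex.exp (2 * π * I / (2 * M + 1)) with hζ
  let v : EuclideanSpace ℂ Λ := WithLp.toLp 2 fun n =>
    ∑ k ∈ Icc (-(R : ℤ)) R, identityCoeff M ζ k * ζ ^ (k * (n ℓ : ℤ))
  have hv : v ∈ V := by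
    have hsum : v = ∑ k ∈ Icc (-(R : ℤ)) R, identityCoeff M ζ k •
        (WithLp.toLp 2 fun n => ζ ^ (k * (n ℓ : ℤ)) : EuclideanSpace ℂ Λ) := by
      ext n
      simp [v]
    rw [hsum]
    refine Submodule.sum_mem _ fun k hk => Submodule.smul_mem _ _ (Submodule.subset_span ?_)
    rw [mem_Icc] at hk
    let kℓ : Λ := fun i => if i = ℓ then ⟨k, by rw [mem_Icc]; omega⟩ else ⟨0, by simp⟩
    have hkℓ : ∀ i, (kℓ i : ℤ) = if i = ℓ then k else 0 := fun i => by
      simp only [kℓ]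
      split_ifs <;> rfl
    refine ⟨kℓ, ?_, ?_⟩
    · simp only [hkℓ]
      have : |(k : ℝ)| ≤ R := by
        rw [abs_le]
        exact ⟨by exact_mod_cast hk.1, by exact_mod_cast hk.2⟩
      simpa [ite_pow, Real.sqrt_sq_eq_abs] using this
    · ext n
      simp only [hkℓ, hζ, ← Complex.exp_int_mul]
      congr 1
      simp
      ring
  have hmin : ‖X ℓ - (Submodule.orthogonalProjectionOnto V (X ℓ) : EuclideanSpace ℂ Λ)‖ ≤
      ‖X ℓ - v‖ := by
    have := Submodule.starProjection_minimal (U := V) (X ℓ)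
    rw [Submodule.starProjection_apply] at this
    rw [this]
    exact ciInf_le ⟨0, by rintro _ ⟨x, rfl⟩; positivity⟩ (⟨v, hv⟩ : V)
  have herr : ‖X ℓ - v‖ ^ 2 = Fintype.card ({j // j ≠ ℓ} → ι) * ∑ n ∈ Icc (-(M : ℤ)) M,
      ‖(n : ℂ) - ∑ k ∈ Icc (-(R : ℤ)) R, identityCoeff M ζ k * ζ ^ (k * n)‖ ^ 2 := by
    rw [EuclideanSpace.norm_sq_eq, ← sum_coe_sort (Icc (-(M : ℤ)) M)]
    exact sum_comp_eval ℓ fun n : ι =>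
      ‖((n : ℤ) : ℂ) - ∑ k ∈ Icc (-(R : ℤ)) R, identityCoeff M ζ k * ζ ^ (k * (n : ℤ))‖ ^ 2
  have htot : ‖X ℓ‖ ^ 2 = Fintype.card ({j // j ≠ ℓ} → ι) *
      ∑ n ∈ Icc (-(M : ℤ)) M, (n : ℝ) ^ 2 := by
    rw [EuclideanSpace.norm_sq_eq, ← sum_coe_sort (Icc (-(M : ℤ)) M),
      ← sum_comp_eval ℓ fun n : ι => ((n : ℤ) : ℝ) ^ 2]
    refine sum_congr rfl fun n _ => ?_
    simp [X]
  calc _ ≤ ‖X ℓ - v‖ ^ 2 := by gcongr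
    _ ≤ _ := by
      rw [herr, htot, mul_left_comm]
      gcongr
      exact sum_norm_sub_truncation_le hR1 hRM
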